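/- arXiv:2604.23496 — 2 statements merged into one kernel-verified Lean document; each statement's English description precedes it below -/
import Mathlib

section
/- Let (ρ, C) be local Lie algebroid data on ℝ^d with fiber ℝ^k. The bracket [e₁,e₂]^a = Σ_{i,b} ρ^i_b (e₁^b ∂_i e₂^a − e₂^b ∂_i e₁^a) + Σ_{b,c} C^a_{bc} e₁^b e₂^c satisfies the Jacobi identity [[e₁,e₂],e₃] + [[e₂,e₃],e₁] + [[e₃,e₁],e₂] = 0 for all smooth sections e₁, e₂, e₃ : ℝ^d → ℝ^k if and only if the structure identities (I) and (II) hold. (These identities are exactly the conditions Q² = 0 for the degree-one vector field Q on E[1], so this is the local form of the statement that a Q-manifold of degree one is equivalent to a Lie algebroid.) -/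
/-- Partial derivative of a scalar function on `ℝ^d` along the `m`-th coordinate. -/
noncomputable def pd {d : ℕ} (m : Fin d) (f : (Fin d → ℝ) → ℝ) (x : Fin d → ℝ) : ℝ :=
  fderiv ℝ f x (Pi.single m 1)

/-- The bracket of sections determined by local Lie algebroid data `(ρ, C)`:
`[e₁,e₂]^a = Σ_{i,b} ρ^i_b (e₁^b ∂_i e₂^a − e₂^b ∂_i e₁^a) + Σ_{b,c} C^a_{bc} e₁^b e₂^c`. -/
noncomputable def laBracket {d k : ℕ}
    (ρ : Fin d → Fin k → (Fin d → ℝ) → ℝ)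
    (C : Fin k → Fin k → Fin k → (Fin d → ℝ) → ℝ)
    (e₁ e₂ : (Fin d → ℝ) → Fin k → ℝ) (x : Fin d → ℝ) (a : Fin k) : ℝ :=
  (∑ i, ∑ b, ρ i b x * (e₁ x b * pd i (fun y => e₂ y a) x - e₂ x b * pd i (fun y => e₁ y a) x))
    + ∑ b, ∑ c, C a b c x * e₁ x b * e₂ x c

/-- Structure identity (I) of local Lie algebroid data. -/
def StructureIdentityI {d k : ℕ}
    (ρ : Fin d → Fin k → (Fin d → ℝ) → ℝ)
    (C : Fin k → Fin k → Fin k → (Fin d → ℝ) → ℝ) : Prop :=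
  ∀ (i : Fin d) (b c : Fin k) (x : Fin d → ℝ),
    ∑ j, (ρ j b x * pd j (fun y => ρ i c y) x - ρ j c x * pd j (fun y => ρ i b y) x)
      = ∑ a, ρ i a x * C a b c x

/-- Structure identity (II) of local Lie algebroid data: the cyclic sum over `(b, c, d')` of
`Σ_i ρ^i_{d'} ∂_i C^a_{bc} − Σ_e C^a_{e d'} C^e_{bc}` vanishes. -/
def StructureIdentityII {d k : ℕ}
    (ρ : Fin d → Fin k → (Fin d → ℝ) → ℝ)
    (C : Fin k → Fin k → Fin k → (Fin d → ℝ) → ℝ) : Prop :=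
  ∀ (a b c d' : Fin k) (x : Fin d → ℝ),
    ((∑ i, ρ i d' x * pd i (fun y => C a b c y) x) - ∑ e, C a e d' x * C e b c x)
      + ((∑ i, ρ i b x * pd i (fun y => C a c d' y) x) - ∑ e, C a e b x * C e c d' x)
      + ((∑ i, ρ i c x * pd i (fun y => C a d' b y) x) - ∑ e, C a e c x * C e d' b x) = 0

/-- The value at `x` of the vector field `ρ(e)`. -/
noncomputable def anchorField {d k : ℕ} (ρ : Fin d → Fin k → (Fin d → ℝ) → ℝ)
    (e : (Fin d → ℝ) → Fin k → ℝ) (x : Fin d → ℝ) : Fin d → ℝ :=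
  fun i => ∑ b, ρ i b x * e x b

/-- The bilinear form on the fiber given by a matrix. -/
def fiberForm {k : ℕ} (c : Fin k → Fin k → ℝ) (u v : Fin k → ℝ) : ℝ :=
  ∑ p, ∑ q, c p q * u p * v q

/-- The defect of structure identity (I). -/
noncomputable def anchorDefect {d k : ℕ} (ρ : Fin d → Fin k → (Fin d → ℝ) → ℝ)
    (C : Fin k → Fin k → Fin k → (Fin d → ℝ) → ℝ)
    (i : Fin d) (b c : Fin k) (x : Fin d → ℝ) : ℝ :=
  ∑ a, ρ i a x * C a b c x
    - ∑ j, (ρ j b x * pd j (fun y => ρ i c y) x - ρ j c x * pd j (fun y => ρ i b y) x)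

/-- One summand of the cyclic sum in structure identity (II). -/
noncomputable def structureTerm {d k : ℕ} (ρ : Fin d → Fin k → (Fin d → ℝ) → ℝ)
    (C : Fin k → Fin k → Fin k → (Fin d → ℝ) → ℝ)
    (a b c d' : Fin k) (x : Fin d → ℝ) : ℝ :=
  (∑ i, ρ i d' x * pd i (fun y => C a b c y) x) - ∑ e, C a e d' x * C e b c x

theorem fderiv_apply_eq_sum_pd {d : ℕ} (g : (Fin d → ℝ) → ℝ) (x v : Fin d → ℝ) :
    fderiv ℝ g x v = ∑ i, v i * pd i g x := by
  conv_lhs => rw [pi_eq_sum_univ' v]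
  simp only [map_sum, map_smul, smul_eq_mul, pd]

theorem fiberForm_add_left {k : ℕ} (c : Fin k → Fin k → ℝ) (u u' v : Fin k → ℝ) :
    fiberForm c (u + u') v = fiberForm c u v + fiberForm c u' v := by
  simp only [fiberForm, Pi.add_apply, mul_add, add_mul, Finset.sum_add_distrib]

theorem fiberForm_sub_left {k : ℕ} (c : Fin k → Fin k → ℝ) (u u' v : Fin k → ℝ) :
    fiberForm c (u - u') v = fiberForm c u v - fiberForm c u' v := by
  simp only [fiberForm, Pi.sub_apply, mul_sub, sub_mul, Finset.sum_sub_distrib]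

theorem fiberForm_swap {k : ℕ} {c : Fin k → Fin k → ℝ} (hc : ∀ p q, c p q = - c q p)
    (u v : Fin k → ℝ) : fiberForm c u v = - fiberForm c v u := by
  simp only [fiberForm]
  rw [Finset.sum_comm, ← Finset.sum_neg_distrib]
  refine Finset.sum_congr rfl fun q _ => ?_
  rw [← Finset.sum_neg_distrib]
  refine Finset.sum_congr rfl fun p _ => ?_
  rw [hc p q]
  ring

theorem laBracket_eq {d k : ℕ} (ρ : Fin d → Fin k → (Fin d → ℝ) → ℝ)
    (C : Fin k → Fin k → Fin k → (Fin d → ℝ) → ℝ)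
    (e₁ e₂ : (Fin d → ℝ) → Fin k → ℝ) (x : Fin d → ℝ) (a : Fin k) :
    laBracket ρ C e₁ e₂ x a =
      fderiv ℝ (fun y => e₂ y a) x (anchorField ρ e₁ x)
        - fderiv ℝ (fun y => e₁ y a) x (anchorField ρ e₂ x)
        + fiberForm (fun b c => C a b c x) (e₁ x) (e₂ x) := by
  simp only [laBracket, fderiv_apply_eq_sum_pd, anchorField, fiberForm, Finset.sum_mul, mul_sub,
    Finset.sum_sub_distrib, mul_assoc]

section Smooth

variable {d k : ℕ} {ρ : Fin d → Fin k → (Fin d → ℝ) → ℝ}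
  {C : Fin k → Fin k → Fin k → (Fin d → ℝ) → ℝ}

theorem contDiff_anchorField (hρ : ∀ i a, ContDiff ℝ (⊤ : ℕ∞) (ρ i a))
    {e : (Fin d → ℝ) → Fin k → ℝ} (he : ContDiff ℝ (⊤ : ℕ∞) e) :
    ContDiff ℝ (⊤ : ℕ∞) (anchorField ρ e) := by
  rw [contDiff_pi] at he ⊢
  exact fun i => ContDiff.sum fun b _ => (hρ i b).mul (he b)

theorem contDiff_fderiv_apply_field {g : (Fin d → ℝ) → ℝ} {V : (Fin d → ℝ) → Fin d → ℝ}
    (hg : ContDiff ℝ (⊤ : ℕ∞) g) (hV : ContDiff ℝ (⊤ : ℕ∞) V) :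
    ContDiff ℝ (⊤ : ℕ∞) (fun y => fderiv ℝ g y (V y)) :=
  (hg.fderiv_right (m := (⊤ : ℕ∞)) (by norm_cast)).clm_apply hV

/-- The commutator of two vector fields, as derivations, is the Lie bracket. -/
theorem fderiv_fderiv_apply_sub {g : (Fin d → ℝ) → ℝ} {V W : (Fin d → ℝ) → Fin d → ℝ}
    (hg : ContDiff ℝ (⊤ : ℕ∞) g) (hV : ContDiff ℝ (⊤ : ℕ∞) V) (hW : ContDiff ℝ (⊤ : ℕ∞) W)
    (x : Fin d → ℝ) :
    fderiv ℝ (fun y => fderiv ℝ g y (W y)) x (V x)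
      - fderiv ℝ (fun y => fderiv ℝ g y (V y)) x (W x)
      = fderiv ℝ g x (fderiv ℝ W x (V x) - fderiv ℝ V x (W x)) := by
  have hg' : DifferentiableAt ℝ (fderiv ℝ g) x :=
    (hg.fderiv_right (m := (⊤ : ℕ∞)) (by norm_cast)).differentiable (by simp) x
  have hsymm : IsSymmSndFDerivAt ℝ g x := hg.contDiffAt.isSymmSndFDerivAt (by
    simpa using (WithTop.coe_le_coe.2 le_top : ((2 : ℕ∞) : WithTop ℕ∞) ≤ ((⊤ : ℕ∞) : WithTop ℕ∞)))
  rw [fderiv_clm_apply hg' (hW.differentiable (by simp) x),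
    fderiv_clm_apply hg' (hV.differentiable (by simp) x)]
  simp [hsymm.eq (V x) (W x)]

theorem fderiv_fiberForm {c : Fin k → Fin k → (Fin d → ℝ) → ℝ}
    {e₁ e₂ : (Fin d → ℝ) → Fin k → ℝ} (hc : ∀ p q, ContDiff ℝ (⊤ : ℕ∞) (c p q))
    (h₁ : ContDiff ℝ (⊤ : ℕ∞) e₁) (h₂ : ContDiff ℝ (⊤ : ℕ∞) e₂) (x v : Fin d → ℝ) :
    fderiv ℝ (fun y => fiberForm (fun p q => c p q y) (e₁ y) (e₂ y)) x v =
      fiberForm (fun p q => fderiv ℝ (c p q) x v) (e₁ x) (e₂ x)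
        + fiberForm (fun p q => c p q x) (fun p => fderiv ℝ (fun y => e₁ y p) x v) (e₂ x)
        + fiberForm (fun p q => c p q x) (e₁ x) (fun q => fderiv ℝ (fun y => e₂ y q) x v) := by
  have hc' : ∀ p q, DifferentiableAt ℝ (c p q) x := fun p q => (hc p q).differentiable (by simp) x
  have h₁' : ∀ p, DifferentiableAt ℝ (fun y => e₁ y p) x :=
    fun p => (contDiff_pi.1 h₁ p).differentiable (by simp) x
  have h₂' : ∀ p, DifferentiableAt ℝ (fun y => e₂ y p) x :=
    fun p => (contDiff_pi.1 h₂ p).differentiable (by simp) x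
  simp only [fiberForm]
  rw [fderiv_fun_sum fun p _ => DifferentiableAt.fun_sum fun q _ =>
    ((hc' p q).fun_mul (h₁' p)).fun_mul (h₂' q)]
  simp only [sum_apply, ← Finset.sum_add_distrib]
  refine Finset.sum_congr rfl fun p _ => ?_
  rw [fderiv_fun_sum fun q _ => ((hc' p q).fun_mul (h₁' p)).fun_mul (h₂' q)]
  simp only [sum_apply]
  refine Finset.sum_congr rfl fun q _ => ?_
  rw [fderiv_fun_mul ((hc' p q).fun_mul (h₁' p)) (h₂' q), fderiv_fun_mul (hc' p q) (h₁' p)]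
  simp only [add_apply, smul_apply, smul_eq_mul]
  ring

theorem contDiff_fiberForm {c : Fin k → Fin k → (Fin d → ℝ) → ℝ}
    {e₁ e₂ : (Fin d → ℝ) → Fin k → ℝ} (hc : ∀ p q, ContDiff ℝ (⊤ : ℕ∞) (c p q))
    (h₁ : ContDiff ℝ (⊤ : ℕ∞) e₁) (h₂ : ContDiff ℝ (⊤ : ℕ∞) e₂) :
    ContDiff ℝ (⊤ : ℕ∞) (fun y => fiberForm (fun p q => c p q y) (e₁ y) (e₂ y)) :=
  ContDiff.sum fun p _ => ContDiff.sum fun q _ =>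
    ((hc p q).mul (contDiff_pi.1 h₁ p)).mul (contDiff_pi.1 h₂ q)

theorem fderiv_anchorField_apply (hρ : ∀ i a, ContDiff ℝ (⊤ : ℕ∞) (ρ i a))
    {e : (Fin d → ℝ) → Fin k → ℝ} (he : ContDiff ℝ (⊤ : ℕ∞) e) (x v : Fin d → ℝ) (i : Fin d) :
    fderiv ℝ (anchorField ρ e) x v i =
      ∑ b, fderiv ℝ (ρ i b) x v * e x b + ∑ b, ρ i b x * fderiv ℝ (fun y => e y b) x v := by
  have hρ' : ∀ b, DifferentiableAt ℝ (ρ i b) x := fun b => (hρ i b).differentiable (by simp) x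
  have he' : ∀ b, DifferentiableAt ℝ (fun y => e y b) x :=
    fun b => (contDiff_pi.1 he b).differentiable (by simp) x
  have happ := congrArg (fun L => L v)
    (fderiv_apply ((contDiff_anchorField hρ he).differentiable (by simp) x) i)
  refine happ.symm.trans ?_
  simp only [anchorField]
  rw [fderiv_fun_sum fun b _ => (hρ' b).fun_mul (he' b)]
  simp only [sum_apply, ← Finset.sum_add_distrib]
  refine Finset.sum_congr rfl fun b _ => ?_
  rw [fderiv_fun_mul (hρ' b) (he' b)]
  simp only [add_apply, smul_apply, smul_eq_mul]
  ring

/-- The failure of the anchor to be a bracket homomorphism is tensorial. -/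
theorem anchorField_laBracket_sub (hρ : ∀ i a, ContDiff ℝ (⊤ : ℕ∞) (ρ i a))
    {e₁ e₂ : (Fin d → ℝ) → Fin k → ℝ}
    (h₁ : ContDiff ℝ (⊤ : ℕ∞) e₁) (h₂ : ContDiff ℝ (⊤ : ℕ∞) e₂) (x : Fin d → ℝ) :
    anchorField ρ (fun y => laBracket ρ C e₁ e₂ y) x
      - (fderiv ℝ (anchorField ρ e₂) x (anchorField ρ e₁ x)
        - fderiv ℝ (anchorField ρ e₁) x (anchorField ρ e₂ x))
      = fun i => fiberForm (fun b c => anchorDefect ρ C i b c x) (e₁ x) (e₂ x) := by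
  ext i
  have hdef : fiberForm (fun b c => anchorDefect ρ C i b c x) (e₁ x) (e₂ x)
      = ∑ a, ρ i a x * fiberForm (fun b c => C a b c x) (e₁ x) (e₂ x)
        - (∑ b, fderiv ℝ (ρ i b) x (anchorField ρ e₁ x) * e₂ x b
          - ∑ b, fderiv ℝ (ρ i b) x (anchorField ρ e₂ x) * e₁ x b) := by
    have hC : ∑ a, ρ i a x * fiberForm (fun b c => C a b c x) (e₁ x) (e₂ x)
        = fiberForm (fun b c => ∑ a, ρ i a x * C a b c x) (e₁ x) (e₂ x) := by
      simp only [fiberForm, Finset.mul_sum, Finset.sum_mul]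
      rw [Finset.sum_comm]
      refine Finset.sum_congr rfl fun b _ => ?_
      rw [Finset.sum_comm]
      simp only [mul_assoc]
    have hρ₁ : ∑ b, fderiv ℝ (ρ i b) x (anchorField ρ e₁ x) * e₂ x b
        = fiberForm (fun b c => ∑ j, ρ j b x * pd j (ρ i c) x) (e₁ x) (e₂ x) := by
      simp only [fiberForm, fderiv_apply_eq_sum_pd, anchorField, Finset.sum_mul]
      symm
      rw [Finset.sum_comm]
      refine Finset.sum_congr rfl fun q _ => ?_
      rw [Finset.sum_comm]
      exact Finset.sum_congr rfl fun p _ => Finset.sum_congr rfl fun j _ => by ring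
    have hρ₂ : ∑ b, fderiv ℝ (ρ i b) x (anchorField ρ e₂ x) * e₁ x b
        = fiberForm (fun b c => ∑ j, ρ j c x * pd j (ρ i b) x) (e₁ x) (e₂ x) := by
      simp only [fiberForm, fderiv_apply_eq_sum_pd, anchorField, Finset.sum_mul]
      refine Finset.sum_congr rfl fun p _ => ?_
      rw [Finset.sum_comm]
      exact Finset.sum_congr rfl fun q _ => Finset.sum_congr rfl fun j _ => by ring
    rw [hC, hρ₁, hρ₂]
    simp only [fiberForm, anchorDefect, sub_mul, Finset.sum_sub_distrib]
  rw [hdef]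
  simp only [Pi.sub_apply, fderiv_anchorField_apply hρ h₁, fderiv_anchorField_apply hρ h₂]
  simp only [anchorField.eq_1 ρ (fun y => laBracket ρ C e₁ e₂ y), laBracket_eq, mul_add, mul_sub,
    Finset.sum_add_distrib, Finset.sum_sub_distrib]
  ring

theorem fderiv_laBracket (hρ : ∀ i a, ContDiff ℝ (⊤ : ℕ∞) (ρ i a))
    (hC : ∀ a b c, ContDiff ℝ (⊤ : ℕ∞) (C a b c)) {e₁ e₂ : (Fin d → ℝ) → Fin k → ℝ}
    (h₁ : ContDiff ℝ (⊤ : ℕ∞) e₁) (h₂ : ContDiff ℝ (⊤ : ℕ∞) e₂) (x v : Fin d → ℝ) (a : Fin k) :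
    fderiv ℝ (fun y => laBracket ρ C e₁ e₂ y a) x v =
      fderiv ℝ (fun y => fderiv ℝ (fun z => e₂ z a) y (anchorField ρ e₁ y)) x v
        - fderiv ℝ (fun y => fderiv ℝ (fun z => e₁ z a) y (anchorField ρ e₂ y)) x v
        + (fiberForm (fun p q => fderiv ℝ (C a p q) x v) (e₁ x) (e₂ x)
        + fiberForm (fun p q => C a p q x) (fun p => fderiv ℝ (fun y => e₁ y p) x v) (e₂ x)
        + fiberForm (fun p q => C a p q x) (e₁ x)
            (fun q => fderiv ℝ (fun y => e₂ y q) x v)) := by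
  have hA := (contDiff_fderiv_apply_field (contDiff_pi.1 h₂ a)
    (contDiff_anchorField hρ h₁)).differentiable (by simp) x
  have hB := (contDiff_fderiv_apply_field (contDiff_pi.1 h₁ a)
    (contDiff_anchorField hρ h₂)).differentiable (by simp) x
  have hF := (contDiff_fiberForm (hC a) h₁ h₂).differentiable (by simp) x
  simp only [laBracket_eq]
  rw [fderiv_fun_add (hA.fun_sub hB) hF, fderiv_fun_sub hA hB, ← fderiv_fiberForm (hC a) h₁ h₂]
  rfl

theorem fiberForm_structureTerm (e₁ e₂ e₃ : (Fin d → ℝ) → Fin k → ℝ) (x : Fin d → ℝ)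
    (a : Fin k) :
    fiberForm (fun p q => fderiv ℝ (C a p q) x (anchorField ρ e₃ x)) (e₁ x) (e₂ x)
      - fiberForm (fun p q => C a p q x)
          (fun p => fiberForm (fun b c => C p b c x) (e₁ x) (e₂ x)) (e₃ x)
      = ∑ b, ∑ c, ∑ f, structureTerm ρ C a b c f x * e₁ x b * e₂ x c * e₃ x f := by
  have hd : fiberForm (fun p q => fderiv ℝ (C a p q) x (anchorField ρ e₃ x)) (e₁ x) (e₂ x)
      = ∑ b, ∑ c, ∑ f, (∑ i, ρ i f x * pd i (C a b c) x) * e₁ x b * e₂ x c * e₃ x f := by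
    simp only [fiberForm, fderiv_apply_eq_sum_pd, anchorField, Finset.sum_mul]
    refine Finset.sum_congr rfl fun b _ => Finset.sum_congr rfl fun c _ => ?_
    rw [Finset.sum_comm]
    exact Finset.sum_congr rfl fun f _ => Finset.sum_congr rfl fun i _ => by ring
  have hq : fiberForm (fun p q => C a p q x)
        (fun p => fiberForm (fun b c => C p b c x) (e₁ x) (e₂ x)) (e₃ x)
      = ∑ b, ∑ c, ∑ f, (∑ p, C a p f x * C p b c x) * e₁ x b * e₂ x c * e₃ x f := by
    simp only [fiberForm, Finset.sum_mul, Finset.mul_sum]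
    rw [Finset.sum_comm_cycle]
    refine Finset.sum_congr rfl fun b _ => ?_
    rw [Finset.sum_comm_cycle]
    refine Finset.sum_congr rfl fun c _ => ?_
    rw [Finset.sum_comm]
    exact Finset.sum_congr rfl fun f _ => Finset.sum_congr rfl fun p _ => by ring
  rw [hd, hq]
  simp only [structureTerm, sub_mul, Finset.sum_sub_distrib]

/-- The Jacobiator in terms of the defects of the two structure identities. -/
theorem laBracket_jacobiator_eq (hρ : ∀ i a, ContDiff ℝ (⊤ : ℕ∞) (ρ i a))
    (hC : ∀ a b c, ContDiff ℝ (⊤ : ℕ∞) (C a b c))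
    (hCskew : ∀ a b c x, C a b c x = - C a c b x) {e₁ e₂ e₃ : (Fin d → ℝ) → Fin k → ℝ}
    (h₁ : ContDiff ℝ (⊤ : ℕ∞) e₁) (h₂ : ContDiff ℝ (⊤ : ℕ∞) e₂) (h₃ : ContDiff ℝ (⊤ : ℕ∞) e₃)
    (a : Fin k) (x : Fin d → ℝ) :
    laBracket ρ C (fun y => laBracket ρ C e₁ e₂ y) e₃ x a
      + laBracket ρ C (fun y => laBracket ρ C e₂ e₃ y) e₁ x a
      + laBracket ρ C (fun y => laBracket ρ C e₃ e₁ y) e₂ x a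
    = fderiv ℝ (fun y => e₃ y a) x
        (fun i => fiberForm (fun b c => anchorDefect ρ C i b c x) (e₁ x) (e₂ x))
      + fderiv ℝ (fun y => e₁ y a) x
        (fun i => fiberForm (fun b c => anchorDefect ρ C i b c x) (e₂ x) (e₃ x))
      + fderiv ℝ (fun y => e₂ y a) x
        (fun i => fiberForm (fun b c => anchorDefect ρ C i b c x) (e₃ x) (e₁ x))
      - ∑ b, ∑ c, ∑ f, (structureTerm ρ C a b c f x + structureTerm ρ C a c f b x
          + structureTerm ρ C a f b c x) * e₁ x b * e₂ x c * e₃ x f := by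
  have key : ∀ {u v w : (Fin d → ℝ) → Fin k → ℝ}, ContDiff ℝ (⊤ : ℕ∞) u →
      ContDiff ℝ (⊤ : ℕ∞) v →
      laBracket ρ C (fun y => laBracket ρ C u v y) w x a =
        fderiv ℝ (fun y => w y a) x
          (fun i => fiberForm (fun b c => anchorDefect ρ C i b c x) (u x) (v x))
        + fderiv ℝ (fun y => w y a) x
          (fderiv ℝ (anchorField ρ v) x (anchorField ρ u x)
            - fderiv ℝ (anchorField ρ u) x (anchorField ρ v x))
        - fderiv ℝ (fun y => fderiv ℝ (fun z => v z a) y (anchorField ρ u y)) x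
            (anchorField ρ w x)
        + fderiv ℝ (fun y => fderiv ℝ (fun z => u z a) y (anchorField ρ v y)) x
            (anchorField ρ w x)
        - fiberForm (fun p q => C a p q x)
            (fun p => fderiv ℝ (fun y => u y p) x (anchorField ρ w x)) (v x)
        + fiberForm (fun p q => C a p q x)
            (fun q => fderiv ℝ (fun y => v y q) x (anchorField ρ w x)) (u x)
        + fiberForm (fun p q => C a p q x)
            (fun q => fderiv ℝ (fun y => v y q) x (anchorField ρ u x)) (w x)
        - fiberForm (fun p q => C a p q x)
            (fun q => fderiv ℝ (fun y => u y q) x (anchorField ρ v x)) (w x)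
        - ∑ b, ∑ c, ∑ f, structureTerm ρ C a b c f x * u x b * v x c * w x f := by
    intro u v w hu hv
    have hsplit : laBracket ρ C u v x =
        (fun q => fderiv ℝ (fun y => v y q) x (anchorField ρ u x))
        - (fun q => fderiv ℝ (fun y => u y q) x (anchorField ρ v x))
        + fun p => fiberForm (fun b c => C p b c x) (u x) (v x) :=
      funext fun p => laBracket_eq ρ C u v x p
    rw [laBracket_eq, fderiv_laBracket hρ hC hu hv, ← fiberForm_structureTerm, hsplit,
      fiberForm_add_left, fiberForm_sub_left, ← anchorField_laBracket_sub hρ hu hv, map_sub,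
      fiberForm_swap (hCskew a · · x) (u x)]
    ring
  rw [key h₁ h₂, key h₂ h₃, key h₃ h₁,
    ← fderiv_fderiv_apply_sub (contDiff_pi.1 h₃ a) (contDiff_anchorField hρ h₁)
      (contDiff_anchorField hρ h₂),
    ← fderiv_fderiv_apply_sub (contDiff_pi.1 h₁ a) (contDiff_anchorField hρ h₂)
      (contDiff_anchorField hρ h₃),
    ← fderiv_fderiv_apply_sub (contDiff_pi.1 h₂ a) (contDiff_anchorField hρ h₃)
      (contDiff_anchorField hρ h₁)]
  have hcyc₂ : ∑ b, ∑ c, ∑ f, structureTerm ρ C a b c f x * e₂ x b * e₃ x c * e₁ x f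
      = ∑ b, ∑ c, ∑ f, structureTerm ρ C a c f b x * e₁ x b * e₂ x c * e₃ x f := by
    rw [Finset.sum_comm_cycle]
    exact Finset.sum_congr rfl fun b _ => Finset.sum_congr rfl fun c _ =>
      Finset.sum_congr rfl fun f _ => by ring
  have hcyc₃ : ∑ b, ∑ c, ∑ f, structureTerm ρ C a b c f x * e₃ x b * e₁ x c * e₂ x f
      = ∑ b, ∑ c, ∑ f, structureTerm ρ C a f b c x * e₁ x b * e₂ x c * e₃ x f := by
    rw [← Finset.sum_comm_cycle]
    exact Finset.sum_congr rfl fun b _ => Finset.sum_congr rfl fun c _ =>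
      Finset.sum_congr rfl fun f _ => by ring
  rw [hcyc₂, hcyc₃]
  simp only [add_mul, Finset.sum_add_distrib]
  ring

end Smooth

theorem fiberForm_single {k : ℕ} (c : Fin k → Fin k → ℝ) (p q : Fin k) :
    fiberForm c (Pi.single p 1) (Pi.single q 1) = c p q := by
  simp [fiberForm, Pi.single_apply]

/-- The bracket of local Lie algebroid data `(ρ, C)` satisfies the Jacobi identity on all
smooth sections iff structure identities (I) and (II) hold (local form of the equivalence
between degree-one Q-manifolds and Lie algebroids). -/
theorem laBracket_jacobi_iff_structure_identities {d k : ℕ}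
    (ρ : Fin d → Fin k → (Fin d → ℝ) → ℝ)
    (C : Fin k → Fin k → Fin k → (Fin d → ℝ) → ℝ)
    (hρ : ∀ i a, ContDiff ℝ (⊤ : ℕ∞) (ρ i a))
    (hC : ∀ a b c, ContDiff ℝ (⊤ : ℕ∞) (C a b c))
    (hCskew : ∀ a b c x, C a b c x = - C a c b x) :
    (∀ e₁ e₂ e₃ : (Fin d → ℝ) → Fin k → ℝ,
        ContDiff ℝ (⊤ : ℕ∞) e₁ → ContDiff ℝ (⊤ : ℕ∞) e₂ → ContDiff ℝ (⊤ : ℕ∞) e₃ →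
        ∀ (a : Fin k) (x : Fin d → ℝ),
          laBracket ρ C (fun y => laBracket ρ C e₁ e₂ y) e₃ x a
            + laBracket ρ C (fun y => laBracket ρ C e₂ e₃ y) e₁ x a
            + laBracket ρ C (fun y => laBracket ρ C e₃ e₁ y) e₂ x a = 0)
      ↔ (StructureIdentityI ρ C ∧ StructureIdentityII ρ C) := by
  constructor
  · intro hJ
    have hII : ∀ a b c f x, structureTerm ρ C a b c f x + structureTerm ρ C a c f b x
        + structureTerm ρ C a f b c x = 0 := by
      intro a b c f x
      have h := hJ (fun _ => Pi.single b 1) (fun _ => Pi.single c 1) (fun _ => Pi.single f 1)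
        contDiff_const contDiff_const contDiff_const a x
      rw [laBracket_jacobiator_eq hρ hC hCskew contDiff_const contDiff_const contDiff_const] at h
      simp only [fderiv_fun_const, Pi.zero_apply, zero_apply, add_zero, zero_sub,
        Pi.single_apply, mul_ite, mul_one, mul_zero, Finset.sum_ite_eq', Finset.mem_univ, if_true,
        neg_eq_zero] at h
      exact h
    refine ⟨fun i b c x => ?_, fun a b c f x => hII a b c f x⟩
    have hlin : ContDiff ℝ (⊤ : ℕ∞) (fun y : Fin d → ℝ => (Pi.single b (y i) : Fin k → ℝ)) :=
      (ContinuousLinearMap.single ℝ (fun _ : Fin k => ℝ) b).contDiff.comp (contDiff_apply ℝ ℝ i)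
    have h := hJ (fun _ => Pi.single b 1) (fun _ => Pi.single c 1) (fun y => Pi.single b (y i))
      contDiff_const contDiff_const hlin b x
    rw [laBracket_jacobiator_eq hρ hC hCskew contDiff_const contDiff_const hlin] at h
    simp only [hII, Pi.single_eq_same, fiberForm_single, zero_mul, Finset.sum_const_zero] at h
    rw [(hasFDerivAt_apply i x).fderiv] at h
    simp [anchorDefect] at h
    simpa [anchorDefect] using (sub_eq_zero.1 h).symm
  · rintro ⟨hI, hII⟩ e₁ e₂ e₃ h₁ h₂ h₃ a x
    have hI' : ∀ i b c, anchorDefect ρ C i b c x = 0 := fun i b c =>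
      sub_eq_zero.2 (hI i b c x).symm
    have hII' : ∀ b c f, structureTerm ρ C a b c f x + structureTerm ρ C a c f b x
        + structureTerm ρ C a f b c x = 0 := fun b c f => hII a b c f x
    have hzero : (fun _ : Fin d => (0 : ℝ)) = 0 := rfl
    rw [laBracket_jacobiator_eq hρ hC hCskew h₁ h₂ h₃]
    simp [hI', hII', fiberForm, hzero]
end

section
/- Let H be any smooth 3-form on ℝ^d. The H-twisted Dorfman bracket is compatible with the canonical pairing: for all generalized vector fields e₁ = (X₁,α₁), e₂, e₃ and every x ∈ ℝ^d, Σ_i X₁^i(x) ∂_i⟨e₂,e₃⟩(x) = ⟨e₁ ∘ e₂, e₃⟩(x) + ⟨e₂, e₁ ∘ e₃⟩(x), where ⟨(X,α),(Y,β)⟩ := Σ_i (α_i Y^i + β_i X^i). (This is Courant algebroid axiom 5 for the H-twisted standard Courant algebroid on ℝ^d, and it holds without assuming H closed.) -/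
/-- A generalized vector field on `ℝ^d`: a pair `(X, α)` of a vector field and a 1-form. -/
abbrev GVF (d : ℕ) := ((Fin d → ℝ) → Fin d → ℝ) × ((Fin d → ℝ) → Fin d → ℝ)

/-- The `H`-twisted Dorfman bracket of generalized vector fields. -/
noncomputable def dorfman {d : ℕ} (H : Fin d → Fin d → Fin d → (Fin d → ℝ) → ℝ)
    (e₁ e₂ : GVF d) : GVF d :=
  (fun x i => ∑ j, (e₁.1 x j * pd j (fun y => e₂.1 y i) x
      - e₂.1 x j * pd j (fun y => e₁.1 y i) x),
   fun x i => (∑ j, (e₁.1 x j * pd j (fun y => e₂.2 y i) x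
        + e₂.2 x j * pd i (fun y => e₁.1 y j) x
        - e₂.1 x j * pd j (fun y => e₁.2 y i) x
        + e₂.1 x j * pd i (fun y => e₁.2 y j) x))
      + ∑ j, ∑ k, H i j k x * e₁.1 x j * e₂.1 x k)

/-- The canonical pairing `⟨(X,α),(Y,β)⟩ = Σ_i (α_i Y^i + β_i X^i)`. -/
def gPair {d : ℕ} (e₁ e₂ : GVF d) (x : Fin d → ℝ) : ℝ :=
  ∑ i, (e₁.2 x i * e₂.1 x i + e₂.2 x i * e₁.1 x i)

/-- Leibniz rule for the canonical pairing. -/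
theorem pd_gPair {d : ℕ} (m : Fin d) (e₂ e₃ : GVF d) (x : Fin d → ℝ)
    (h₂X : DifferentiableAt ℝ e₂.1 x) (h₂α : DifferentiableAt ℝ e₂.2 x)
    (h₃X : DifferentiableAt ℝ e₃.1 x) (h₃α : DifferentiableAt ℝ e₃.2 x) :
    pd m (fun y => gPair e₂ e₃ y) x
      = ∑ i, (e₂.2 x i * pd m (fun y => e₃.1 y i) x + e₃.1 x i * pd m (fun y => e₂.2 y i) x
        + (e₃.2 x i * pd m (fun y => e₂.1 y i) x + e₂.1 x i * pd m (fun y => e₃.2 y i) x)) := by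
  have a := differentiableAt_pi.1 h₂X
  have b := differentiableAt_pi.1 h₂α
  have c := differentiableAt_pi.1 h₃X
  have e := differentiableAt_pi.1 h₃α
  have key : HasFDerivAt (fun y => gPair e₂ e₃ y) _ x := HasFDerivAt.fun_sum fun i _ =>
    ((b i).hasFDerivAt.mul (c i).hasFDerivAt).add ((e i).hasFDerivAt.mul (a i).hasFDerivAt)
  simp [pd, key.fderiv]

/-- Contracting a tensor antisymmetric in its outer indices with a product symmetrized in those
indices gives zero. -/
theorem sum_antisymm_contract {ι R : Type*} [Fintype ι] [CommRing R] (T : ι → ι → ι → R)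
    (hT : ∀ i j k, T i j k = -T k j i) (u v w : ι → R) :
    ∑ i, (∑ j, ∑ k, T i j k * u j * v k) * w i
      + ∑ i, (∑ j, ∑ k, T i j k * u j * w k) * v i = 0 := by
  have swap : ∑ i, (∑ j, ∑ k, T i j k * u j * w k) * v i
      = ∑ i, ∑ j, ∑ k, T k j i * u j * w i * v k := by
    simp only [Finset.sum_mul]
    rw [Finset.sum_congr rfl fun i _ => Finset.sum_comm, Finset.sum_comm]
    exact Finset.sum_congr rfl fun i _ => Finset.sum_comm
  rw [swap]
  simp only [Finset.sum_mul, ← Finset.sum_add_distrib]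
  refine Finset.sum_eq_zero fun i _ => Finset.sum_eq_zero fun j _ =>
    Finset.sum_eq_zero fun k _ => ?_
  rw [hT i j k]
  ring

/-- Courant algebroid axiom 5 for the `H`-twisted standard Courant algebroid on `ℝ^d`:
the Dorfman bracket is compatible with the canonical pairing (for any smooth 3-form `H`,
not necessarily closed). -/
theorem dorfman_pairing_compatible {d : ℕ}
    (H : Fin d → Fin d → Fin d → (Fin d → ℝ) → ℝ)
    (hH : ∀ i j k, ContDiff ℝ (⊤ : ℕ∞) (H i j k))
    (hHanti₁ : ∀ i j k x, H i j k x = - H j i k x)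
    (hHanti₂ : ∀ i j k x, H i j k x = - H i k j x)
    (e₁ e₂ e₃ : GVF d)
    (h₁X : ContDiff ℝ (⊤ : ℕ∞) e₁.1) (h₁α : ContDiff ℝ (⊤ : ℕ∞) e₁.2)
    (h₂X : ContDiff ℝ (⊤ : ℕ∞) e₂.1) (h₂α : ContDiff ℝ (⊤ : ℕ∞) e₂.2)
    (h₃X : ContDiff ℝ (⊤ : ℕ∞) e₃.1) (h₃α : ContDiff ℝ (⊤ : ℕ∞) e₃.2)
    (x : Fin d → ℝ) :
    ∑ i, e₁.1 x i * pd i (fun y => gPair e₂ e₃ y) x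
      = gPair (dorfman H e₁ e₂) e₃ x + gPair e₂ (dorfman H e₁ e₃) x := by
  have diff {f : (Fin d → ℝ) → Fin d → ℝ} (hf : ContDiff ℝ (⊤ : ℕ∞) f) :
      DifferentiableAt ℝ f x := (hf.differentiable (by simp)).differentiableAt
  have flux := sum_antisymm_contract (fun i j k => H i j k x)
    (fun i j k => by rw [hHanti₁ i j k x, hHanti₂ j i k x, hHanti₁ j k i x, neg_neg])
    (e₁.1 x) (e₂.1 x) (e₃.1 x)
  simp only [fun i => pd_gPair i e₂ e₃ x (diff h₂X) (diff h₂α) (diff h₃X) (diff h₃α)]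
  have swap := Finset.sum_comm (s := Finset.univ) (t := Finset.univ) (f := fun i j =>
    e₂.2 x j * pd i (fun y => e₁.1 y j) x * e₃.1 x i
      + e₃.2 x j * pd i (fun y => e₁.1 y j) x * e₂.1 x i
      + e₂.1 x j * pd i (fun y => e₁.2 y j) x * e₃.1 x i
      + e₃.1 x j * pd i (fun y => e₁.2 y j) x * e₂.1 x i)
  simp only [Finset.mul_sum]
  rw [Finset.sum_comm]
  simp only [gPair, dorfman, mul_add, mul_sub, Finset.mul_sum,
    Finset.sum_add_distrib, Finset.sum_sub_distrib, mul_comm, mul_left_comm] at flux swap ⊢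
  linarith
end
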